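/- arXiv:1812.06324 — 2 statements merged into one kernel-verified Lean document; each statement's English description precedes it below -/
import Mathlib

section
/- Let n > 1 be a positive odd integer. Then for each k with 0 <= k <= (n-1)/2, the sum of the k-th term and the ((n-1)/2-k)-th term of the series sum_{k=0}^{(n-1)/2} [4k+1] * (q;q^2)_k^6/(q^2;q^2)_k^6 * q^k is congruent to 0 modulo Phi_n(q); here [m] = (1-q^m)/(1-q). Consequently sum_{k=0}^{(n-1)/2} [4k+1] (q;q^2)_k^6/(q^2;q^2)_k^6 q^k ≡ 0 (mod Phi_n(q)) as rational functions whose denominators are coprime to Phi_n(q). -/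
open Finset Polynomial

/-- The `q`-shifted factorial `(a;q)_k`. -/
noncomputable def qp {F : Type*} [Field F] (a q : F) (k : ℕ) : F :=
  ∏ j ∈ Finset.range k, (1 - a * q ^ j)

/-- The `q`-integer `[m]` as a rational function. -/
noncomputable def qint (m : ℕ) : RatFunc ℚ :=
  ∑ i ∈ Finset.range m, RatFunc.X ^ i

/-- The `q`-integer `[m]` as a polynomial. -/
noncomputable def qnat (m : ℕ) : Polynomial ℚ :=
  ∑ i ∈ Finset.range m, Polynomial.X ^ i

/-- The `q`-binomial coefficient as a rational function. -/
noncomputable def qbin (n k : ℕ) : RatFunc ℚ :=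
  qp RatFunc.X RatFunc.X n / (qp RatFunc.X RatFunc.X k * qp RatFunc.X RatFunc.X (n - k))

/-- The rational function `r` is regular at `z`, with value `v` there. -/
def HasValueAt (z : ℂ) (r : RatFunc ℚ) (v : ℂ) : Prop :=
  ∃ N D : ℚ[X], aeval z D ≠ 0 ∧ r * algebraMap ℚ[X] (RatFunc ℚ) D = algebraMap _ _ N ∧
    aeval z N = v * aeval z D

namespace HasValueAt

variable {z : ℂ} {r s : RatFunc ℚ} {v w : ℂ}

theorem of_polynomial (z : ℂ) (p : ℚ[X]) :
    HasValueAt z (algebraMap ℚ[X] (RatFunc ℚ) p) (aeval z p) :=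
  ⟨p, 1, by simp, by simp, by simp⟩

theorem X (z : ℂ) : HasValueAt z RatFunc.X z := by
  simpa using HasValueAt.of_polynomial z Polynomial.X

theorem one (z : ℂ) : HasValueAt z 1 1 := by
  simpa using HasValueAt.of_polynomial z 1

theorem zero (z : ℂ) : HasValueAt z 0 0 := by
  simpa using HasValueAt.of_polynomial z 0

theorem add (hr : HasValueAt z r v) (hs : HasValueAt z s w) :
    HasValueAt z (r + s) (v + w) := by
  obtain ⟨N, D, hD, h, e⟩ := hr
  obtain ⟨N', D', hD', h', e'⟩ := hs
  refine ⟨N * D' + N' * D, D * D', by simp [hD, hD'], ?_, ?_⟩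
  · simp only [map_add, map_mul, ← h, ← h']; ring
  · simp only [map_add, map_mul, e, e']; ring

theorem mul (hr : HasValueAt z r v) (hs : HasValueAt z s w) :
    HasValueAt z (r * s) (v * w) := by
  obtain ⟨N, D, hD, h, e⟩ := hr
  obtain ⟨N', D', hD', h', e'⟩ := hs
  refine ⟨N * N', D * D', by simp [hD, hD'], ?_, ?_⟩
  · simp only [map_mul, ← h, ← h']; ring
  · simp only [map_mul, e, e']; ring

theorem neg (hr : HasValueAt z r v) : HasValueAt z (-r) (-v) := by
  simpa using (HasValueAt.of_polynomial z (-1)).mul hr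

theorem sub (hr : HasValueAt z r v) (hs : HasValueAt z s w) :
    HasValueAt z (r - s) (v - w) := by
  simpa only [sub_eq_add_neg] using hr.add hs.neg

theorem pow (hr : HasValueAt z r v) (k : ℕ) : HasValueAt z (r ^ k) (v ^ k) := by
  induction k with
  | zero => simpa using HasValueAt.one z
  | succ k ih => simpa only [pow_succ] using ih.mul hr

theorem inv (hr : HasValueAt z r v) (hv : v ≠ 0) : HasValueAt z r⁻¹ v⁻¹ := by
  obtain ⟨N, D, hD, h, e⟩ := hr
  have hN : aeval z N ≠ 0 := by rw [e]; exact mul_ne_zero hv hD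
  have hN0 : (algebraMap ℚ[X] (RatFunc ℚ)) N ≠ 0 := by
    rw [Ne, FaithfulSMul.algebraMap_eq_zero_iff]
    rintro rfl
    simp at hN
  have hr0 : r ≠ 0 := by
    rintro rfl
    exact hN0 (by rw [← h, zero_mul])
  exact ⟨D, N, hN, by rw [← h, inv_mul_cancel_left₀ hr0], by
    rw [e, inv_mul_cancel_left₀ hv]⟩

theorem div (hr : HasValueAt z r v) (hs : HasValueAt z s w) (hw : w ≠ 0) :
    HasValueAt z (r / s) (v / w) := by
  simpa only [div_eq_mul_inv] using hr.mul (hs.inv hw)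

theorem sum {ι : Type*} {f : ι → RatFunc ℚ} {g : ι → ℂ} {S : Finset ι}
    (h : ∀ i ∈ S, HasValueAt z (f i) (g i)) :
    HasValueAt z (∑ i ∈ S, f i) (∑ i ∈ S, g i) := by
  classical
  induction S using Finset.induction_on with
  | empty => simpa using HasValueAt.zero z
  | insert a S ha ih =>
    rw [Finset.sum_insert ha, Finset.sum_insert ha]
    exact (h a (Finset.mem_insert_self a S)).add
      (ih fun i hi => h i (Finset.mem_insert_of_mem hi))

theorem qp {a q : RatFunc ℚ} {a' q' : ℂ} (ha : HasValueAt z a a') (hq : HasValueAt z q q')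
    (k : ℕ) : HasValueAt z (qp a q k) (qp a' q' k) := by
  induction k with
  | zero => simpa [_root_.qp] using HasValueAt.one z
  | succ k ih =>
    simp only [_root_.qp, Finset.prod_range_succ] at ih ⊢
    exact ih.mul ((HasValueAt.one z).sub (ha.mul (hq.pow k)))

theorem qint (z : ℂ) (m : ℕ) : HasValueAt z (qint m) (∑ i ∈ Finset.range m, z ^ i) :=
  HasValueAt.sum fun i _ => (HasValueAt.X z).pow i

/-- A rational function vanishing at a primitive `n`-th root of unity has numerator divisible by
the `n`-th cyclotomic polynomial. -/
theorem cyclotomic_dvd_num {n : ℕ} (hn : 0 < n) (hz : IsPrimitiveRoot z n)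
    (h : HasValueAt z r 0) : cyclotomic n ℚ ∣ r.num := by
  obtain ⟨N, D, hD, h, e⟩ := h
  have key : r.num * D = N * r.denom := by
    apply RatFunc.algebraMap_injective ℚ
    have hd : (algebraMap ℚ[X] (RatFunc ℚ)) r.denom ≠ 0 :=
      RatFunc.algebraMap_ne_zero r.denom_ne_zero
    rw [map_mul, map_mul, ← h]
    nth_rw 2 [← RatFunc.num_div_denom r]
    field_simp
  rw [cyclotomic_eq_minpoly_rat hz hn]
  apply minpoly.dvd
  have := congrArg (aeval z) key
  rw [map_mul, map_mul, e, zero_mul, zero_mul] at this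
  exact (mul_eq_zero.mp this).resolve_right hD

end HasValueAt

theorem qp_succ {F : Type*} [Field F] (a q : F) (k : ℕ) :
    qp a q (k + 1) = qp a q k * (1 - a * q ^ k) :=
  Finset.prod_range_succ _ _

section RootOfUnity

variable {F : Type*} [Field F] {z : F} {m : ℕ}

theorem qp_sq_ne_zero (hz : IsPrimitiveRoot z (2 * m + 1)) {k : ℕ} (hk : k ≤ m) :
    qp (z ^ 2) (z ^ 2) k ≠ 0 := by
  refine Finset.prod_ne_zero_iff.mpr fun j hj => ?_
  have hj := Finset.mem_range.mp hj
  rw [sub_ne_zero, ← pow_mul, ← pow_add]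
  exact (hz.pow_ne_one_of_pos_of_lt (by omega) (by omega)).symm

theorem qp_odd_eq_qp_even (hz : z ^ (2 * m + 1) = 1) :
    qp z (z ^ 2) m = (-1) ^ m * z ^ m ^ 2 * qp (z ^ 2) (z ^ 2) m := by
  have hexp : ∏ j ∈ Finset.range m, z ^ (2 * j + 1) = z ^ m ^ 2 := by
    clear hz
    induction m with
    | zero => simp
    | succ m ih => rw [Finset.prod_range_succ, ih, ← pow_add]; congr 1; ring
  have hsign : ∏ _j ∈ Finset.range m, (-1 : F) = (-1) ^ m := by simp
  rw [qp, qp, ← Finset.prod_range_reflect (fun j => 1 - z ^ 2 * (z ^ 2) ^ j), ← hexp, ← hsign,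
    ← Finset.prod_mul_distrib, ← Finset.prod_mul_distrib]
  refine Finset.prod_congr rfl fun j hj => ?_
  have hj := Finset.mem_range.mp hj
  have h : z ^ (2 * j + 1) * (z ^ 2 * (z ^ 2) ^ (m - 1 - j)) = 1 := by
    rw [← pow_mul, ← pow_add, ← pow_add, ← hz]
    congr 1
    omega
  linear_combination -h

/-- The ratio `(q;q²)_k / (q²;q²)_k` at a root of unity of order `2m+1`, under `k ↦ m - k`. -/
theorem qp_reflect (hz : z ^ (2 * m + 1) = 1) {k : ℕ} (hk : k ≤ m) :
    qp z (z ^ 2) (m - k) * qp (z ^ 2) (z ^ 2) k =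
      (-1) ^ m * z ^ (m ^ 2 + k) * (qp z (z ^ 2) k * qp (z ^ 2) (z ^ 2) (m - k)) := by
  induction k with
  | zero => simpa [qp] using qp_odd_eq_qp_even hz
  | succ k ih =>
    obtain ⟨l, rfl⟩ : ∃ l, m = l + (k + 1) := ⟨m - (k + 1), by omega⟩
    have ih := ih (by omega)
    rw [show l + (k + 1) - k = l + 1 by omega, qp_succ, qp_succ] at ih
    rw [show l + (k + 1) - (k + 1) = l by omega, qp_succ, qp_succ, ← add_assoc (_ ^ 2) k 1,
      pow_succ z ((l + (k + 1)) ^ 2 + k), ← mul_assoc ((-1) ^ _)]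
    have h₁ : z ^ 2 * (z ^ 2) ^ k * (z * (z ^ 2) ^ l) = 1 := by rw [← hz]; ring
    generalize (-1 : F) ^ (l + (k + 1)) * z ^ ((l + (k + 1)) ^ 2 + k) = c at *
    linear_combination (-(z ^ 2 * (z ^ 2) ^ k)) * ih +
      (c * z * qp z (z ^ 2) k * qp (z ^ 2) (z ^ 2) l - qp z (z ^ 2) l * qp (z ^ 2) (z ^ 2) k) * h₁

theorem geom_sum_reflect (hz : z ^ (2 * m + 1) = 1) (hz1 : z ≠ 1) {k : ℕ} (hk : k ≤ m) :
    (∑ i ∈ Finset.range (4 * (m - k) + 1), z ^ i) * z ^ (4 * k + 1) =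
      -∑ i ∈ Finset.range (4 * k + 1), z ^ i := by
  apply mul_right_cancel₀ (sub_ne_zero.mpr hz1)
  have h : z ^ (4 * (m - k) + 1) * z ^ (4 * k + 1) = 1 := by
    rw [← pow_add, show 4 * (m - k) + 1 + (4 * k + 1) = (2 * m + 1) * 2 by omega, pow_mul, hz,
      one_pow]
  linear_combination z ^ (4 * k + 1) * geom_sum_mul z (4 * (m - k) + 1) +
    geom_sum_mul z (4 * k + 1) + h

/-- The `k`-th term of the series `∑ [4k+1] (q;q²)_k⁶ / (q²;q²)_k⁶ q^k`, evaluated at `z`. -/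
noncomputable def seriesTerm (z : F) (k : ℕ) : F :=
  (∑ i ∈ Finset.range (4 * k + 1), z ^ i) * qp z (z ^ 2) k ^ 6 / qp (z ^ 2) (z ^ 2) k ^ 6 * z ^ k

theorem seriesTerm_reflect (hm : 0 < m) (hz : IsPrimitiveRoot z (2 * m + 1)) {k : ℕ}
    (hk : k ≤ m) : seriesTerm z (m - k) = -seriesTerm z k := by
  have hB := qp_sq_ne_zero hz hk
  have hB' := qp_sq_ne_zero hz (Nat.sub_le m k)
  have hratio : qp z (z ^ 2) (m - k) / qp (z ^ 2) (z ^ 2) (m - k) =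
      (-1) ^ m * z ^ (m ^ 2 + k) * (qp z (z ^ 2) k / qp (z ^ 2) (z ^ 2) k) := by
    rw [mul_div_assoc', div_eq_div_iff hB' hB]
    linear_combination qp_reflect hz.pow_eq_one hk
  have hsign : ((-1 : F) ^ m) ^ 6 = 1 := by
    rw [← pow_mul, mul_comm, pow_mul]; norm_num
  have hpow : (z ^ (m ^ 2 + k)) ^ 6 * z ^ (m - k) = z ^ (4 * k + 1) * z ^ k := by
    obtain ⟨l, rfl⟩ : ∃ l, m = l + k := ⟨m - k, by omega⟩
    obtain ⟨p, hp⟩ : ∃ p, l + k = p + 1 := ⟨l + k - 1, by omega⟩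
    have hexp : ((l + k) ^ 2 + k) * 6 + l = 4 * k + 1 + k + (2 * (l + k) + 1) * (3 * p + 2) := by
      rw [hp]
      nlinarith [hp]
    rw [Nat.add_sub_cancel, ← pow_mul, ← pow_add, ← pow_add, hexp, pow_add, pow_mul z (2 * _ + 1),
      hz.pow_eq_one, one_pow, mul_one]
  have hgeom := geom_sum_reflect hz.pow_eq_one (hz.ne_one (by omega)) hk
  rw [seriesTerm, seriesTerm, mul_div_assoc, mul_div_assoc, ← div_pow, ← div_pow, hratio]
  generalize qp z (z ^ 2) k / qp (z ^ 2) (z ^ 2) k = R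
  rw [mul_pow, mul_pow, hsign, one_mul]
  linear_combination (∑ i ∈ Finset.range (4 * (m - k) + 1), z ^ i) * R ^ 6 * hpow +
    R ^ 6 * z ^ k * hgeom

end RootOfUnity

theorem hasValueAt_seriesTerm {z : ℂ} {m : ℕ} (hz : IsPrimitiveRoot z (2 * m + 1)) {k : ℕ}
    (hk : k ≤ m) :
    HasValueAt z (qint (4 * k + 1) * qp RatFunc.X (RatFunc.X ^ 2) k ^ 6 /
      qp (RatFunc.X ^ 2) (RatFunc.X ^ 2) k ^ 6 * RatFunc.X ^ k) (seriesTerm z k) := by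
  have hX := HasValueAt.X z
  exact (((HasValueAt.qint z _).mul ((hX.qp (hX.pow 2) k).pow 6)).div
    (((hX.pow 2).qp (hX.pow 2) k).pow 6) (pow_ne_zero 6 (qp_sq_ne_zero hz hk))).mul (hX.pow k)

/-- pairing of terms modulo `Φ_n(q)` and the resulting congruence
for the truncated sum `∑_{k=0}^{(n-1)/2} [4k+1] (q;q^2)_k^6/(q^2;q^2)_k^6 q^k`. -/
theorem stmt3 (n : ℕ) (hn : 1 < n) (hodd : Odd n) :
    letI q : RatFunc ℚ := RatFunc.X
    letI t : ℕ → RatFunc ℚ := fun j =>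
      qint (4 * j + 1) * (qp q (q ^ 2) j) ^ 6 / (qp (q ^ 2) (q ^ 2) j) ^ 6 * q ^ j
    (∀ k ≤ (n - 1) / 2,
        Polynomial.cyclotomic n ℚ ∣ (t k + t ((n - 1) / 2 - k)).num) ∧
    Polynomial.cyclotomic n ℚ ∣ (∑ k ∈ Finset.range ((n - 1) / 2 + 1), t k).num := by
  obtain ⟨m, rfl⟩ := hodd
  have hm : 0 < m := by omega
  have hz : IsPrimitiveRoot (Complex.exp (2 * Real.pi * Complex.I / (2 * m + 1 : ℕ))) (2 * m + 1) :=
    Complex.isPrimitiveRoot_exp _ (by omega)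
  generalize Complex.exp (2 * Real.pi * Complex.I / (2 * m + 1 : ℕ)) = z at hz
  rw [show (2 * m + 1 - 1) / 2 = m by omega]
  refine ⟨fun k hk => ?_, ?_⟩
  · have h := (hasValueAt_seriesTerm hz hk).add (hasValueAt_seriesTerm hz (Nat.sub_le m k))
    rw [seriesTerm_reflect hm hz hk, add_neg_cancel] at h
    exact h.cyclotomic_dvd_num (by omega) hz
  · have hsum : ∑ k ∈ Finset.range (m + 1), seriesTerm z k = 0 := by
      rw [← self_eq_neg, ← Finset.sum_neg_distrib]
      nth_rw 1 [← Finset.sum_range_reflect]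
      refine Finset.sum_congr rfl fun k hk => ?_
      exact seriesTerm_reflect hm hz (Nat.lt_succ_iff.mp (Finset.mem_range.mp hk))
    have h := HasValueAt.sum (S := Finset.range (m + 1)) fun k hk =>
      hasValueAt_seriesTerm hz (Nat.lt_succ_iff.mp (Finset.mem_range.mp hk))
    rw [hsum] at h
    exact h.cyclotomic_dvd_num (by omega) hz
end

section
/- Let n and r be positive integers. Then sum_{k=0}^{n} q^{(r-2)k} [4k+1] * [2k choose k]_q^{2r} * (-q^{k+1};q)_{n-k}^{4r} ≡ 0 (mod [n+1][2n+1]), where [m] is the q-integer, [2k choose k]_q the central q-binomial coefficient, and (x;q)_m the q-shifted factorial; i.e., the polynomial on the left is divisible by [n+1]_q [2n+1]_q in Z[q]. -/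
open Finset Polynomial

/-- The `q`-factorial `(q;q)_k` as a polynomial. -/
noncomputable def qfact (k : ℕ) : ℚ[X] := ∏ j ∈ range k, (1 - X ^ (j + 1))

theorem qfact_succ (k : ℕ) : qfact (k + 1) = qfact k * (1 - X ^ (k + 1)) :=
  prod_range_succ _ _

theorem one_sub_X_pow_succ_ne_zero (j : ℕ) : (1 - X ^ (j + 1) : ℚ[X]) ≠ 0 := by
  intro h
  simpa using congrArg (eval 0) h

theorem qfact_ne_zero (k : ℕ) : qfact k ≠ 0 :=
  prod_ne_zero_iff.mpr fun j _ => one_sub_X_pow_succ_ne_zero j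

theorem algebraMap_qfact (k : ℕ) :
    algebraMap ℚ[X] (RatFunc ℚ) (qfact k) = qp RatFunc.X RatFunc.X k := by
  simp [qfact, qp, map_prod, RatFunc.algebraMap_X, pow_succ']

/-- The `q`-binomial coefficients are polynomials. -/
theorem qfact_mul_qfact_dvd (m k : ℕ) : qfact k * qfact m ∣ qfact (m + k) := by
  induction m generalizing k with
  | zero => simp [qfact]
  | succ m ihm =>
    induction k with
    | zero => simp [qfact]
    | succ k ihk =>
      obtain ⟨a, ha⟩ := ihk
      obtain ⟨b, hb⟩ := ihm (k + 1)
      refine ⟨a + X ^ (k + 1) * b, ?_⟩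
      rw [show m + 1 + (k + 1) = m + k + 1 + 1 by ring, qfact_succ]
      rw [show m + 1 + k = m + k + 1 by ring] at ha
      rw [show m + (k + 1) = m + k + 1 by ring] at hb
      rw [qfact_succ] at ha hb ⊢
      rw [qfact_succ m] at ha ⊢
      rw [qfact_succ k] at hb ⊢
      linear_combination (1 - X ^ (k + 1)) * ha + X ^ (k + 1) * (1 - X ^ (m + 1)) * hb

/-- The central `q`-binomial coefficient as a polynomial. -/
noncomputable def qcentral (k : ℕ) : ℚ[X] := (qfact_mul_qfact_dvd k k).choose

theorem qfact_mul_qfact_mul_qcentral (k : ℕ) :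
    qfact k * qfact k * qcentral k = qfact (2 * k) := by
  rw [two_mul]
  exact (qfact_mul_qfact_dvd k k).choose_spec.symm

theorem algebraMap_qcentral (k : ℕ) :
    algebraMap ℚ[X] (RatFunc ℚ) (qcentral k) = qbin (2 * k) k := by
  have h0 : algebraMap ℚ[X] (RatFunc ℚ) (qfact k) ≠ 0 :=
    RatFunc.algebraMap_ne_zero (qfact_ne_zero k)
  rw [qbin, show 2 * k - k = k by lia, ← algebraMap_qfact, ← algebraMap_qfact,
    ← qfact_mul_qfact_mul_qcentral, map_mul, map_mul]
  field_simp

theorem qcentral_succ (k : ℕ) :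
    qcentral (k + 1) * (1 - X ^ (k + 1)) =
      qcentral k * ((1 + X ^ (k + 1)) * (1 - X ^ (2 * k + 1))) := by
  have h := qfact_mul_qfact_mul_qcentral (k + 1)
  rw [show 2 * (k + 1) = 2 * k + 1 + 1 by ring, qfact_succ (2 * k + 1), qfact_succ (2 * k),
    ← qfact_mul_qfact_mul_qcentral k, qfact_succ k] at h
  have h0 : qfact k * qfact k * (1 - X ^ (k + 1)) ≠ 0 :=
    mul_ne_zero (mul_ne_zero (qfact_ne_zero k) (qfact_ne_zero k)) (one_sub_X_pow_succ_ne_zero k)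
  refine mul_left_cancel₀ h0 ?_
  linear_combination h

/-- The sum, multiplied by `q ^ (2 * n)`, as a polynomial. -/
noncomputable def guoSum (n r : ℕ) : ℚ[X] :=
  ∑ k ∈ range (n + 1), X ^ (r * k + 2 * (n - k)) * qnat (4 * k + 1) * qcentral k ^ (2 * r) *
    (∏ j ∈ range (n - k), (1 + X ^ (k + 1 + j))) ^ (4 * r)

theorem algebraMap_guoSum (n r : ℕ) :
    algebraMap ℚ[X] (RatFunc ℚ) (guoSum n r) =
      (∑ k ∈ Finset.range (n + 1),
        (RatFunc.X : RatFunc ℚ) ^ (((r : ℤ) - 2) * (k : ℤ)) * qint (4 * k + 1) *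
          (qbin (2 * k) k) ^ (2 * r) *
            (qp (-((RatFunc.X : RatFunc ℚ) ^ (k + 1))) RatFunc.X (n - k)) ^ (4 * r)) *
        RatFunc.X ^ (2 * n) := by
  rw [guoSum, map_sum, Finset.sum_mul]
  refine sum_congr rfl fun k hk => ?_
  have hk : k ≤ n := by simpa [Nat.lt_succ_iff] using hk
  have hX : (RatFunc.X : RatFunc ℚ) ≠ 0 := RatFunc.X_ne_zero
  have hpow : (RatFunc.X : RatFunc ℚ) ^ (r * k + 2 * (n - k)) =
      RatFunc.X ^ (((r : ℤ) - 2) * (k : ℤ)) * RatFunc.X ^ (2 * n) := by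
    rw [← zpow_natCast, ← zpow_natCast, ← zpow_add₀ hX]
    congr 1
    push_cast [Nat.cast_sub hk]
    ring
  simp only [map_mul, map_pow, algebraMap_qcentral, RatFunc.algebraMap_X, hpow, map_prod,
    map_add, map_one, qint, qnat, map_sum, qp, neg_mul, sub_neg_eq_add, ← pow_add]
  ring

section RootOfUnity

variable {K : Type*} [Field K] {q : K} {M : ℕ}

theorem IsPrimitiveRoot.one_sub_pow_two_mul_ne_zero (hq : IsPrimitiveRoot q (2 * M + 1)) {j : ℕ}
    (h0 : 0 < j) (hj : j < 2 * M + 1) : 1 - q ^ (2 * j) ≠ 0 := by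
  intro h
  have h1 : 2 * M + 1 ∣ 2 * j := (hq.pow_eq_one_iff_dvd _).1 (sub_eq_zero.1 h).symm
  have h2 : 2 * M + 1 ∣ j := (Nat.Coprime.dvd_mul_left (by simp)).1 h1
  exact absurd (Nat.le_of_dvd h0 h2) (by lia)

theorem IsPrimitiveRoot.one_add_pow_ne_zero (hq : IsPrimitiveRoot q (2 * M + 1))
    (h2 : (2 : K) ≠ 0) (j : ℕ) : 1 + q ^ j ≠ 0 := by
  intro h
  have h1 : q ^ j = -1 := by linear_combination h
  have h3 : (q ^ j) ^ (2 * M + 1) = 1 := by rw [← pow_mul, mul_comm, pow_mul, hq.pow_eq_one, one_pow]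
  rw [h1, Odd.neg_one_pow ⟨M, rfl⟩] at h3
  exact h2 (by linear_combination -h3)

/-- The solutions of the recurrence satisfied by `(q;q²)_k / (q²;q²)_k`. -/
def IsQHalfBinom (q : K) (u : ℕ → K) : Prop :=
  ∀ k, u (k + 1) * (1 - q ^ (2 * k + 2)) = u k * (1 - q ^ (2 * k + 1))

/-- The summand of the reduced sum. -/
def guoTerm (q : K) (r : ℕ) (u : ℕ → K) (k : ℕ) : K :=
  q ^ (r * k) * q⁻¹ ^ (2 * k) * (1 - q ^ (4 * k + 1)) * u k ^ (2 * r)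

theorem IsQHalfBinom.shift {u : ℕ → K} (hu : IsQHalfBinom q u) {c : ℕ} (hc : q ^ c = 1) :
    IsQHalfBinom q fun j => u (c + j) := by
  intro j
  have h := hu (c + j)
  have e1 : q ^ (2 * (c + j) + 2) = q ^ (2 * j + 2) := by
    rw [show 2 * (c + j) + 2 = c * 2 + (2 * j + 2) by ring, pow_add, pow_mul, hc]; simp
  have e2 : q ^ (2 * (c + j) + 1) = q ^ (2 * j + 1) := by
    rw [show 2 * (c + j) + 1 = c * 2 + (2 * j + 1) by ring, pow_add, pow_mul, hc]; simp
  rwa [e1, e2] at h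

theorem guoTerm_add (r : ℕ) (u : ℕ → K) {c : ℕ} (hc : q ^ c = 1) (j : ℕ) :
    guoTerm q r u (c + j) = guoTerm q r (fun i => u (c + i)) j := by
  have hc' : q⁻¹ ^ c = 1 := by rw [inv_pow, hc, inv_one]
  have e1 : q ^ (r * (c + j)) = q ^ (r * j) := by
    rw [show r * (c + j) = c * r + r * j by ring, pow_add, pow_mul, hc]; simp
  have e2 : q⁻¹ ^ (2 * (c + j)) = q⁻¹ ^ (2 * j) := by
    rw [show 2 * (c + j) = c * 2 + 2 * j by ring, pow_add, pow_mul, hc']; simp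
  have e3 : q ^ (4 * (c + j) + 1) = q ^ (4 * j + 1) := by
    rw [show 4 * (c + j) + 1 = c * 4 + (4 * j + 1) by ring, pow_add, pow_mul, hc]; simp
  simp only [guoTerm, e1, e2, e3]

theorem IsQHalfBinom.eq_zero_of_le {u : ℕ → K} (hu : IsQHalfBinom q u)
    (hq : IsPrimitiveRoot q (2 * M + 1)) {i : ℕ} (hi : u i = 0) {j : ℕ} (hij : i ≤ j)
    (hj : j < 2 * M + 1) : u j = 0 := by
  induction j, hij using Nat.le_induction with
  | base => exact hi
  | succ j _ ih =>
    have h := hu j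
    rw [ih (by lia), zero_mul] at h
    exact (mul_eq_zero.1 h).resolve_right
      (hq.one_sub_pow_two_mul_ne_zero (j := j + 1) (by lia) hj)

theorem IsQHalfBinom.eq_zero {u : ℕ → K} (hu : IsQHalfBinom q u)
    (hq : IsPrimitiveRoot q (2 * M + 1)) {j : ℕ} (hM : M < j) (hj : j < 2 * M + 1) : u j = 0 := by
  refine hu.eq_zero_of_le hq (i := M + 1) ?_ hM hj
  have h := hu M
  rw [hq.pow_eq_one, sub_self, mul_zero] at h
  exact (mul_eq_zero.1 h).resolve_right
    (hq.one_sub_pow_two_mul_ne_zero (j := M + 1) (by lia) (by lia))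

theorem IsQHalfBinom.reflect {u : ℕ → K} (hu : IsQHalfBinom q u)
    (hq : IsPrimitiveRoot q (2 * M + 1)) {j : ℕ} (hj : j ≤ M) :
    u 0 * u (M - j) = u M * q ^ j * u j := by
  induction j with
  | zero => simp [mul_comm]
  | succ j ih =>
    obtain ⟨i, rfl⟩ : ∃ i, M = i + (j + 1) := ⟨M - (j + 1), by lia⟩
    have ih := ih (by lia)
    rw [show i + (j + 1) - j = i + 1 by lia] at ih
    rw [show i + (j + 1) - (j + 1) = i by lia]
    have h1 := hu j
    have h2 := hu i
    have hne := hq.one_sub_pow_two_mul_ne_zero (j := j + 1) (by lia) (by lia)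
    have e1 : q ^ (2 * i + 2) * q ^ (2 * j + 1) = 1 := by
      rw [← pow_add, ← hq.pow_eq_one]; ring
    have e2 : q ^ (2 * i + 1) * q ^ (2 * j + 2) = 1 := by
      rw [← pow_add, ← hq.pow_eq_one]; ring
    have h3 : u (i + 1) * q * (1 - q ^ (2 * j + 1)) = u i * (1 - q ^ (2 * j + 2)) := by
      linear_combination (-q ^ (2 * j + 2)) * h2 + u i * e2 - u (i + 1) * q * e1
    refine mul_right_cancel₀ hne ?_
    rw [show 2 * (j + 1) = 2 * j + 2 by ring, pow_succ]
    linear_combination (-u 0) * h3 + q * (1 - q ^ (2 * j + 1)) * ih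
      - u (i + (j + 1)) * q ^ j * q * h1

theorem IsQHalfBinom.reflect_sq {u : ℕ → K} (hu : IsQHalfBinom q u)
    (hq : IsPrimitiveRoot q (2 * M + 1)) {j : ℕ} (hj : j ≤ M) :
    u (M - j) ^ 2 * q ^ M = q ^ (2 * j) * u j ^ 2 := by
  by_cases h0 : u 0 = 0
  · rw [hu.eq_zero_of_le hq h0 (Nat.zero_le j) (by lia),
      hu.eq_zero_of_le hq h0 (Nat.zero_le (M - j)) (by lia)]
    simp
  · have h1 := hu.reflect hq hj
    have h2 := hu.reflect hq le_rfl
    rw [Nat.sub_self] at h2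
    refine mul_left_cancel₀ (pow_ne_zero 2 h0) ?_
    rw [show q ^ (2 * j) = (q ^ j) ^ 2 by ring]
    linear_combination q ^ M * (u 0 * u (M - j) + u M * q ^ j * u j) * h1
      - (q ^ j) ^ 2 * u j ^ 2 * h2

theorem IsQHalfBinom.guoTerm_reflect {u : ℕ → K} (hu : IsQHalfBinom q u)
    (hq : IsPrimitiveRoot q (2 * M + 1)) (r : ℕ) {j : ℕ} (hj : j ≤ M) :
    guoTerm q r u (M - j) = -guoTerm q r u j := by
  have hq0 : q ≠ 0 := hq.ne_zero (by lia)
  have h1 : (u (M - j) ^ 2 * q ^ M) ^ r = (q ^ (2 * j) * u j ^ 2) ^ r := by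
    rw [hu.reflect_sq hq hj]
  obtain ⟨i, rfl⟩ : ∃ i, M = i + j := ⟨M - j, by lia⟩
  rw [show i + j - j = i by lia] at h1 ⊢
  have h2 : u i ^ (2 * r) * q ^ (r * i) = q ^ (r * j) * u j ^ (2 * r) := by
    refine mul_right_cancel₀ (pow_ne_zero (r * j) hq0) ?_
    linear_combination h1
  have e1 : q ^ (2 * i + 2 * j + 1) = 1 := by rw [← hq.pow_eq_one]; ring
  have h3 : q⁻¹ ^ (2 * i) * (1 - q ^ (4 * i + 1)) = -(q⁻¹ ^ (2 * j) * (1 - q ^ (4 * j + 1))) := by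
    rw [inv_pow, inv_pow]
    field_simp
    linear_combination (q ^ (2 * i) + q ^ (2 * j)) * -e1
  simp only [guoTerm]
  linear_combination q⁻¹ ^ (2 * i) * (1 - q ^ (4 * i + 1)) * h2
    + q ^ (r * j) * u j ^ (2 * r) * h3

theorem IsQHalfBinom.sum_guoTerm_half {u : ℕ → K} (hu : IsQHalfBinom q u)
    (hq : IsPrimitiveRoot q (2 * M + 1)) (h2 : (2 : K) ≠ 0) (r : ℕ) :
    ∑ j ∈ range (M + 1), guoTerm q r u j = 0 := by
  have h : ∑ j ∈ range (M + 1), guoTerm q r u j = -∑ j ∈ range (M + 1), guoTerm q r u j := by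
    conv_lhs => rw [← sum_range_reflect]
    rw [← sum_neg_distrib]
    refine sum_congr rfl fun j hj => ?_
    rw [show M + 1 - 1 - j = M - j by lia]
    exact hu.guoTerm_reflect hq r (by simpa [Nat.lt_succ_iff] using hj)
  exact (mul_eq_zero.1 (show 2 * _ = (0 : K) by linear_combination h)).resolve_left h2

theorem IsQHalfBinom.sum_guoTerm_period {u : ℕ → K} (hu : IsQHalfBinom q u)
    (hq : IsPrimitiveRoot q (2 * M + 1)) (h2 : (2 : K) ≠ 0) {r : ℕ} (hr : 0 < r) :
    ∑ j ∈ range (2 * M + 1), guoTerm q r u j = 0 := by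
  rw [show 2 * M + 1 = M + 1 + M by ring, sum_range_add, hu.sum_guoTerm_half hq h2, zero_add]
  refine sum_eq_zero fun j hj => ?_
  rw [mem_range] at hj
  rw [guoTerm, hu.eq_zero hq (by lia) (by lia), zero_pow (by lia), mul_zero]

theorem IsQHalfBinom.sum_guoTerm_periods {u : ℕ → K} (hu : IsQHalfBinom q u)
    (hq : IsPrimitiveRoot q (2 * M + 1)) (h2 : (2 : K) ≠ 0) {r : ℕ} (hr : 0 < r) (m : ℕ) :
    ∑ j ∈ range ((2 * M + 1) * m), guoTerm q r u j = 0 := by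
  induction m with
  | zero => simp
  | succ m ih =>
    have hc : q ^ ((2 * M + 1) * m) = 1 := by rw [pow_mul, hq.pow_eq_one, one_pow]
    rw [mul_add_one, sum_range_add, ih, zero_add]
    simp only [guoTerm_add r u hc]
    exact (hu.shift hc).sum_guoTerm_period hq h2 hr

theorem IsQHalfBinom.sum_guoTerm_eq_zero {u : ℕ → K} (hu : IsQHalfBinom q u)
    (hq : IsPrimitiveRoot q (2 * M + 1)) (h2 : (2 : K) ≠ 0) {n r : ℕ} (hr : 0 < r)
    (hn : 2 * M + 1 ∣ n + 1 ∨ 2 * M + 1 ∣ 2 * n + 1) :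
    ∑ j ∈ range (n + 1), guoTerm q r u j = 0 := by
  rcases hn with ⟨m, hm⟩ | ⟨m, hm⟩
  · rw [hm]
    exact hu.sum_guoTerm_periods hq h2 hr m
  · have hodd : Odd m := (Nat.odd_mul.1 (hm ▸ ⟨n, rfl⟩ : Odd ((2 * M + 1) * m))).2
    obtain ⟨s, rfl⟩ := hodd
    have hc : q ^ ((2 * M + 1) * s) = 1 := by rw [pow_mul, hq.pow_eq_one, one_pow]
    rw [show n + 1 = (2 * M + 1) * s + (M + 1) by linarith, sum_range_add,
      hu.sum_guoTerm_periods hq h2 hr, zero_add]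
    simp only [guoTerm_add r u hc]
    exact (hu.shift hc).sum_guoTerm_half hq h2 r

end RootOfUnity

section Evaluation

variable {ζ : ℂ}

theorem aeval_qcentral_succ (ζ : ℂ) (k : ℕ) :
    aeval ζ (qcentral (k + 1)) * (1 - ζ ^ (k + 1)) =
      aeval ζ (qcentral k) * ((1 + ζ ^ (k + 1)) * (1 - ζ ^ (2 * k + 1))) := by
  simpa using congrArg (aeval ζ) (qcentral_succ k)

theorem aeval_guoSum_of_odd {M n r : ℕ} (hζ : IsPrimitiveRoot ζ (2 * M + 1)) (hM : 0 < M)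
    (hr : 0 < r) (hn : 2 * M + 1 ∣ n + 1 ∨ 2 * M + 1 ∣ 2 * n + 1) :
    aeval ζ (guoSum n r) = 0 := by
  have hplus := hζ.one_add_pow_ne_zero two_ne_zero
  have hζ0 : ζ ≠ 0 := hζ.ne_zero (by lia)
  have hζ1 : 1 - ζ ≠ 0 := sub_ne_zero.2 (hζ.ne_one (by lia)).symm
  set A : ℕ → ℂ := fun k => ∏ j ∈ range k, (1 + ζ ^ (j + 1)) with hA
  have hA0 (k : ℕ) : A k ≠ 0 := prod_ne_zero_iff.2 fun j _ => hplus (j + 1)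
  have hAsucc (k : ℕ) : A (k + 1) = A k * (1 + ζ ^ (k + 1)) := prod_range_succ _ _
  set u : ℕ → ℂ := fun k => aeval ζ (qcentral k) / A k ^ 2 with hu_def
  have hu : IsQHalfBinom ζ u := by
    intro k
    have h := aeval_qcentral_succ ζ k
    have h1 := hA0 k
    have h2 := hplus (k + 1)
    simp only [hu_def, hAsucc]
    rw [show (1 : ℂ) - ζ ^ (2 * k + 2) = (1 - ζ ^ (k + 1)) * (1 + ζ ^ (k + 1)) by ring]
    field_simp
    linear_combination h
  have hsum := hu.sum_guoTerm_eq_zero hζ two_ne_zero hr hn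
  refine (mul_eq_zero.1 (?_ : (1 - ζ) * aeval ζ (guoSum n r) = 0)).resolve_left hζ1
  rw [← mul_zero (ζ ^ (2 * n) * A n ^ (4 * r)), ← hsum, guoSum, map_sum, mul_sum, mul_sum]
  refine sum_congr rfl fun k hk => ?_
  obtain ⟨i, rfl⟩ : ∃ i, n = k + i := ⟨n - k, by rw [mem_range] at hk; lia⟩
  have hprod : A (k + i) = A k * ∏ j ∈ range i, (1 + ζ ^ (k + 1 + j)) := by
    rw [hA]
    simp only [prod_range_add]
    congr 1
    refine prod_congr rfl fun j _ => ?_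
    rw [add_right_comm]
  have hgeom : (1 - ζ) * aeval ζ (qnat (4 * k + 1)) = 1 - ζ ^ (4 * k + 1) := by
    simp only [qnat, map_sum, map_pow, aeval_X]
    exact mul_neg_geom_sum ζ _
  have hb : aeval ζ (qcentral k) = u k * A k ^ 2 := by
    simp only [hu_def]
    rw [div_mul_cancel₀ _ (pow_ne_zero 2 (hA0 k))]
  have hpow : ζ ^ (r * k + 2 * i) = ζ ^ (2 * (k + i)) * (ζ ^ (r * k) * ζ⁻¹ ^ (2 * k)) := by
    rw [inv_pow]
    field_simp
    ring
  simp only [map_mul, map_pow, map_prod, map_add, map_one, aeval_X, Nat.add_sub_cancel_left,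
    guoTerm, hb, hprod, hpow, ← hgeom]
  ring

theorem aeval_qcentral_eq_zero {e : ℕ} (he : 0 < e) (hζ : IsPrimitiveRoot ζ (2 * e))
    (hneg : ζ ^ e = -1) (a : ℕ) {i : ℕ} (hei : e ≤ i) (hi : i < 2 * e) :
    aeval ζ (qcentral (2 * e * a + i)) = 0 := by
  have hpow (j : ℕ) : ζ ^ (2 * e * a + j) = ζ ^ j := by
    rw [pow_add, pow_mul, hζ.pow_eq_one, one_pow, one_mul]
  have hne {j : ℕ} (h0 : 0 < j) (hj : j < 2 * e) : 1 - ζ ^ (2 * e * a + j) ≠ 0 := by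
    rw [hpow]
    exact sub_ne_zero.2 (hζ.pow_ne_one_of_pos_of_lt h0.ne' hj).symm
  induction i, hei using Nat.le_induction with
  | base =>
    obtain ⟨f, rfl⟩ : ∃ f, e = f + 1 := ⟨e - 1, by lia⟩
    have h := aeval_qcentral_succ ζ (2 * (f + 1) * a + f)
    rw [add_assoc (2 * (f + 1) * a), hpow (f + 1), hneg, add_neg_cancel, zero_mul, mul_zero,
      ← hneg, ← hpow (f + 1)] at h
    exact (mul_eq_zero.1 h).resolve_right (hne he hi)
  | succ i _ ih =>
    have h := aeval_qcentral_succ ζ (2 * e * a + i)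
    rw [ih (by lia), zero_mul, add_assoc (2 * e * a)] at h
    exact (mul_eq_zero.1 h).resolve_right (hne (by lia) hi)

theorem aeval_guoSum_of_even {e n r : ℕ} (he : 0 < e) (hζ : IsPrimitiveRoot ζ (2 * e))
    (hr : 0 < r) (hn : 2 * e ∣ n + 1) : aeval ζ (guoSum n r) = 0 := by
  have hneg : ζ ^ e = -1 := by
    have h : IsPrimitiveRoot (ζ ^ e) 2 := hζ.pow (by lia) (mul_comm 2 e)
    exact h.eq_neg_one_of_two_right
  obtain ⟨m, hm⟩ := hn
  rw [guoSum, map_sum]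
  refine sum_eq_zero fun k hk => ?_
  rw [mem_range] at hk
  have hk_div : 2 * e * (k / (2 * e)) + k % (2 * e) = k := Nat.div_add_mod k (2 * e)
  have hmod : k % (2 * e) < 2 * e := Nat.mod_lt _ (by lia)
  generalize k / (2 * e) = a at hk_div
  generalize k % (2 * e) = i at hk_div hmod
  subst hk_div
  rcases lt_or_ge i e with hi | hi
  · have ham : a < m := by
      by_contra! hma
      have : 2 * e * m ≤ 2 * e * a := Nat.mul_le_mul_left _ hma
      lia
    have hle : 2 * e * a + 2 * e ≤ n + 1 := by
      rw [hm, ← mul_add_one]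
      exact Nat.mul_le_mul_left _ ham
    have hprod : ∏ j ∈ range (n - (2 * e * a + i)), (1 + ζ ^ (2 * e * a + i + 1 + j)) = 0 := by
      refine prod_eq_zero (i := e - i - 1) (mem_range.2 (by lia)) ?_
      rw [show 2 * e * a + i + 1 + (e - i - 1) = 2 * e * a + e by lia, pow_add, pow_mul,
        hζ.pow_eq_one, hneg]
      simp
    simp only [map_mul, map_pow, map_prod, map_add, map_one, aeval_X]
    rw [hprod, zero_pow (by lia), mul_zero]
  · rw [map_mul, map_mul, map_pow _ (qcentral _), aeval_qcentral_eq_zero he hζ hneg a hi hmod,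
      zero_pow (by lia), mul_zero, zero_mul]

theorem aeval_guoSum {d n r : ℕ} (hζ : IsPrimitiveRoot ζ d) (hd : d ≠ 1) (hr : 0 < r)
    (hn : d ∣ n + 1 ∨ d ∣ 2 * n + 1) : aeval ζ (guoSum n r) = 0 := by
  obtain ⟨M, rfl | rfl⟩ := d.even_or_odd'
  · have h1 : 2 * M ∣ n + 1 := hn.resolve_right fun h => by
      have : 2 ∣ 2 * n + 1 := (Dvd.intro M rfl).trans h
      lia
    have hM : 0 < M := Nat.pos_of_ne_zero fun h => by simp [h] at h1
    exact aeval_guoSum_of_even hM hζ hr h1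
  · exact aeval_guoSum_of_odd hζ (by lia) hr hn

end Evaluation

theorem qnat_dvd_of_forall_cyclotomic_dvd {N : ℕ} (hN : 0 < N) {P : ℚ[X]}
    (h : ∀ d, d ∣ N → d ≠ 1 → cyclotomic d ℚ ∣ P) : qnat N ∣ P := by
  rw [qnat, ← prod_cyclotomic_eq_geom_sum hN]
  refine Finset.prod_dvd_of_coprime (fun i _ j _ hij => cyclotomic.isCoprime_rat hij) fun d hd => ?_
  rw [mem_erase, Nat.mem_divisors] at hd
  exact h d hd.2.1 hd.1

theorem isCoprime_qnat {N N' : ℕ} (hN : 0 < N) (hN' : 0 < N') (h : N.Coprime N') :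
    IsCoprime (qnat N) (qnat N') := by
  rw [qnat, qnat, ← prod_cyclotomic_eq_geom_sum hN, ← prod_cyclotomic_eq_geom_sum hN']
  refine IsCoprime.prod_left fun i hi => IsCoprime.prod_right fun j hj =>
    cyclotomic.isCoprime_rat ?_
  rintro rfl
  rw [mem_erase, Nat.mem_divisors] at hi hj
  exact hi.1 (Nat.eq_one_of_dvd_coprimes h hi.2.1 hj.2.1)

theorem cyclotomic_dvd_num_of_mul_X_pow {S : RatFunc ℚ} {P : ℚ[X]} {e d : ℕ}
    (h : algebraMap ℚ[X] (RatFunc ℚ) P = S * RatFunc.X ^ e) (hd : 0 < d)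
    (hP : ∀ ζ : ℂ, IsPrimitiveRoot ζ d → aeval ζ P = 0) : cyclotomic d ℚ ∣ S.num := by
  have hζ := Complex.isPrimitiveRoot_exp d hd.ne'
  set ζ := Complex.exp (2 * Real.pi * Complex.I / d)
  have hnum : S.num * X ^ e = P * S.denom := by
    apply RatFunc.algebraMap_injective ℚ
    have hS := RatFunc.num_div_denom S
    have hden : algebraMap ℚ[X] (RatFunc ℚ) S.denom ≠ 0 :=
      RatFunc.algebraMap_ne_zero S.denom_ne_zero
    rw [div_eq_iff hden] at hS
    rw [map_mul, map_mul, map_pow, RatFunc.algebraMap_X, h, hS]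
    ring
  rw [cyclotomic_eq_minpoly_rat hζ hd]
  refine minpoly.dvd ℚ ζ ?_
  have h1 := congrArg (aeval ζ) hnum
  rw [map_mul, map_mul, hP ζ hζ, zero_mul, map_pow, aeval_X] at h1
  exact (mul_eq_zero.1 h1).resolve_right (pow_ne_zero _ (hζ.ne_zero hd.ne'))

/-- the weak form of Guo'\''s conjecture (8.2b):
`∑_{k=0}^n q^{(r-2)k} [4k+1] [2k,k]_q^{2r} (-q^{k+1};q)_{n-k}^{4r}
≡ 0 (mod [n+1][2n+1])`. -/
theorem stmt16 (n r : ℕ) (hn : 0 < n) (hr : 0 < r) :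
    letI q : RatFunc ℚ := RatFunc.X
    (qnat (n + 1) * qnat (2 * n + 1)) ∣
      (∑ k ∈ Finset.range (n + 1),
        q ^ (((r : ℤ) - 2) * (k : ℤ)) * qint (4 * k + 1) *
          (qbin (2 * k) k) ^ (2 * r) * (qp (-(q ^ (k + 1))) q (n - k)) ^ (4 * r)).num := by
  refine (isCoprime_qnat (by lia) (by lia) ?_).mul_dvd
    (qnat_dvd_of_forall_cyclotomic_dvd (by lia) fun d hd hd1 => ?_)
    (qnat_dvd_of_forall_cyclotomic_dvd (by lia) fun d hd hd1 => ?_)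
  · rw [show 2 * n + 1 = n + (n + 1) by ring]
    simp
  · exact cyclotomic_dvd_num_of_mul_X_pow (algebraMap_guoSum n r) (Nat.pos_of_dvd_of_pos hd (by lia))
      fun ζ hζ => aeval_guoSum hζ hd1 hr (.inl hd)
  · exact cyclotomic_dvd_num_of_mul_X_pow (algebraMap_guoSum n r) (Nat.pos_of_dvd_of_pos hd (by lia))
      fun ζ hζ => aeval_guoSum hζ hd1 hr (.inr hd)
end
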